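/- Let H₁, H₂ be complex Hilbert spaces of finite dimensions d₁, d₂ > 1, H = H₁⊗H₂, and let φ¹ ∈ H₁, φ² ∈ H₂ be unit vectors. Then the convex hull of the set {(U₁ P_{φ¹} U₁†)⊗(U₂ P_{φ²} U₂†) : U₁ ∈ U(H₁), U₂ ∈ U(H₂)} of all pure separable states has nonempty interior in the affine space u*₁(H) of trace-one Hermitian operators on H; that is, the set of separable mixed states is a convex body in u*₁(H). -/

import Mathlib

open Matrix
open scoped Kronecker

noncomputable section

/-- The pure state (rank-one projection) `|ψ⟩⟨ψ|` associated with a vector `ψ`. -/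
def pureState {n : Type*} [Fintype n] (ψ : n → ℂ) : Matrix n n ℂ :=
  Matrix.vecMulVec ψ (star ψ)

/-- `ψ` is a unit vector. -/
def IsUnitVec {n : Type*} [Fintype n] (ψ : n → ℂ) : Prop :=
  ∑ p, Complex.normSq (ψ p) = 1

/-- The affine space `u*₁(H)` of trace-one Hermitian operators on `H`. -/
def traceOne (n : Type*) [Fintype n] [DecidableEq n] : Set (Matrix n n ℂ) :=
  {A | A.IsHermitian ∧ A.trace = 1}

theorem isUnitVec_iff_norm {n : Type*} [Fintype n] (ψ : n → ℂ) :
    IsUnitVec ψ ↔ ‖WithLp.toLp 2 ψ‖ = 1 := by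
  rw [EuclideanSpace.norm_eq, Real.sqrt_eq_one]
  simp [IsUnitVec, Complex.normSq_eq_norm_sq]

/-- Every unit vector is the image of a basis vector under a unitary matrix. -/
theorem IsUnitVec.exists_unitary_mulVec_single {n : Type*} [Fintype n] [DecidableEq n]
    {ψ : n → ℂ} (hψ : IsUnitVec ψ) (i : n) :
    ∃ U ∈ Matrix.unitaryGroup n ℂ, U *ᵥ Pi.single i 1 = ψ := by
  have horth : Orthonormal ℂ
      (({i} : Set n).domRestrict fun _ => (WithLp.toLp 2 ψ : EuclideanSpace ℂ n)) := by
    rw [orthonormal_iff_ite]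
    rintro ⟨a, rfl⟩ ⟨b, rfl⟩
    simp [inner_self_eq_norm_sq_to_K, (isUnitVec_iff_norm ψ).1 hψ]
  obtain ⟨b, hb⟩ := horth.exists_orthonormalBasis_extension_of_card_eq (by simp)
  refine ⟨_, (EuclideanSpace.basisFun n ℂ).toMatrix_orthonormalBasis_mem_unitary b, ?_⟩
  ext j
  simp [Module.Basis.toMatrix_apply, hb i rfl]

/-- The unitary group acts transitively on unit vectors. -/
theorem IsUnitVec.exists_unitary_mulVec_eq {n : Type*} [Fintype n] [DecidableEq n]
    {φ ψ : n → ℂ} (hφ : IsUnitVec φ) (hψ : IsUnitVec ψ) (i : n) :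
    ∃ U ∈ Matrix.unitaryGroup n ℂ, U *ᵥ φ = ψ := by
  obtain ⟨V, hV, rfl⟩ := hφ.exists_unitary_mulVec_single i
  obtain ⟨W, hW, rfl⟩ := hψ.exists_unitary_mulVec_single i
  refine ⟨W * star V, mul_mem hW (Unitary.star_mem hV), ?_⟩
  rw [mulVec_mulVec, mul_assoc, Matrix.mem_unitaryGroup_iff'.1 hV, mul_one]

theorem mul_pureState_mul_conjTranspose {n : Type*} [Fintype n] (U : Matrix n n ℂ) (φ : n → ℂ) :
    U * pureState φ * Uᴴ = pureState (U *ᵥ φ) := by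
  rw [pureState, pureState, mul_vecMulVec, vecMulVec_mul, star_mulVec]

theorem pureState_isHermitian {n : Type*} [Fintype n] (ψ : n → ℂ) :
    (pureState ψ).IsHermitian := by
  ext i j
  simp [pureState, vecMulVec_apply, mul_comm]

theorem IsUnitVec.trace_pureState {n : Type*} [Fintype n] {ψ : n → ℂ} (hψ : IsUnitVec ψ) :
    (pureState ψ).trace = 1 := by
  simp only [pureState, Matrix.trace, diag_apply, vecMulVec_apply, Pi.star_apply]
  rw [← Complex.ofReal_one, ← hψ]
  simp [Complex.normSq_eq_conj_mul_self, mul_comm]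

theorem trace_mul_mul_conjTranspose_of_mem_unitaryGroup {n : Type*} [Fintype n] [DecidableEq n]
    {U : Matrix n n ℂ} (hU : U ∈ Matrix.unitaryGroup n ℂ) (A : Matrix n n ℂ) :
    (U * A * Uᴴ).trace = A.trace := by
  rw [trace_mul_comm, ← mul_assoc, ← star_eq_conjTranspose, Matrix.mem_unitaryGroup_iff'.1 hU,
    one_mul]

/-- The orbit of a pure state under the unitary group. -/
def pureStateOrbit {n : Type*} [Fintype n] [DecidableEq n] (φ : n → ℂ) : Set (Matrix n n ℂ) :=
  {A | ∃ U ∈ Matrix.unitaryGroup n ℂ, A = U * pureState φ * Uᴴ}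

theorem pureState_mem_span_pureStateOrbit {n : Type*} [Fintype n] [DecidableEq n] {φ : n → ℂ}
    (hφ : IsUnitVec φ) (v : n → ℂ) :
    pureState v ∈ Submodule.span ℂ (pureStateOrbit φ) := by
  by_cases hv : v = 0
  · have : pureState v = 0 := by simp [pureState, hv]
    rw [this]
    exact zero_mem _
  obtain ⟨i, -⟩ := Function.ne_iff.1 hv
  set x : EuclideanSpace ℂ n := WithLp.toLp 2 v with hx
  have hx0 : x ≠ 0 := by simpa [hx] using hv
  set c : ℂ := (‖x‖ : ℂ) with hc
  have hc0 : c ≠ 0 := by simpa [hc] using hx0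
  have hunit : IsUnitVec (c⁻¹ • v) := by
    rw [isUnitVec_iff_norm, WithLp.toLp_smul, ← hx, hc]
    exact norm_smul_inv_norm hx0
  obtain ⟨U, hU, hUφ⟩ := hφ.exists_unitary_mulVec_eq hunit i
  have hscale : pureState v = (c * star c) • pureState (c⁻¹ • v) := by
    have hc1 : star c ≠ 0 := star_ne_zero.2 hc0
    ext j k
    simp only [pureState, vecMulVec_apply, Matrix.smul_apply, Pi.smul_apply, Pi.star_apply, star_smul,
      smul_eq_mul, star_inv₀]
    field_simp
  rw [hscale]
  refine Submodule.smul_mem _ _ (Submodule.subset_span ⟨U, hU, ?_⟩)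
  rw [mul_pureState_mul_conjTranspose, hUφ]

/-- Polarization identity for rank-one operators. -/
theorem vecMulVec_star_eq_sum_pureState {n : Type*} [Fintype n] (u v : n → ℂ) :
    vecMulVec u (star v) = (4⁻¹ : ℂ) • (pureState (u + v) - pureState (u - v)
      + Complex.I • pureState (u + Complex.I • v)
      - Complex.I • pureState (u - Complex.I • v)) := by
  ext j k
  simp only [pureState, vecMulVec_apply, Matrix.smul_apply, Matrix.add_apply, Matrix.sub_apply,
    Pi.add_apply, Pi.sub_apply, Pi.smul_apply, Pi.star_apply, smul_eq_mul, star_add, star_sub, star_mul',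
    RCLike.star_def, Complex.conj_I]
  linear_combination ((1 / 2 : ℂ) * (u j * (starRingEnd ℂ) (v k))
    - (1 / 2 : ℂ) * (v j * (starRingEnd ℂ) (u k))) * Complex.I_sq

theorem span_pureStateOrbit {n : Type*} [Fintype n] [DecidableEq n] {φ : n → ℂ}
    (hφ : IsUnitVec φ) : Submodule.span ℂ (pureStateOrbit φ) = ⊤ := by
  refine eq_top_iff.2 fun A _ => ?_
  rw [matrix_eq_sum_single A]
  refine Submodule.sum_mem _ fun i _ => Submodule.sum_mem _ fun j _ => ?_
  have hsingle : single i j (A i j) =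
      A i j • vecMulVec (Pi.single i 1) (star (Pi.single j (1 : ℂ))) := by
    ext k l
    by_cases hk : i = k <;> by_cases hl : j = l <;>
      simp [vecMulVec_apply, hk, hl, eq_comm]
  rw [hsingle, vecMulVec_star_eq_sum_pureState]
  have h := pureState_mem_span_pureStateOrbit hφ
  exact Submodule.smul_mem _ _ (Submodule.smul_mem _ _ (sub_mem (add_mem (sub_mem (h _) (h _))
    (Submodule.smul_mem _ _ (h _))) (Submodule.smul_mem _ _ (h _))))

/-- Kronecker products of two spanning sets of matrices span. -/
theorem span_image2_kronecker_eq_top {m n : Type*} [Fintype m] [Fintype n] [DecidableEq m]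
    [DecidableEq n] {S : Set (Matrix m m ℂ)} {T : Set (Matrix n n ℂ)}
    (hS : Submodule.span ℂ S = ⊤) (hT : Submodule.span ℂ T = ⊤) :
    Submodule.span ℂ (Set.image2 (fun A B => A ⊗ₖ B) S T) = ⊤ := by
  have h := Submodule.map₂_span_span ℂ (kroneckerBilinear (R := ℂ) (α := ℂ)
    (l := m) (m := m) (n := n) (p := n)) S T
  rw [hS, hT] at h
  refine eq_top_iff.2 fun A _ => ?_
  rw [matrix_eq_sum_single A]
  refine Submodule.sum_mem _ fun i _ => Submodule.sum_mem _ fun j _ => ?_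
  have hsingle : single i j (A i j) =
      single i.1 j.1 (A i j) ⊗ₖ single i.2 j.2 (1 : ℂ) := by
    rw [single_kronecker_single, mul_one]
  rw [hsingle]
  exact h.le (Submodule.apply_mem_map₂ _ Submodule.mem_top Submodule.mem_top)

/-- A Hermitian matrix in the complex span of a set of Hermitian matrices is a real linear
combination of them. -/
theorem Matrix.IsHermitian.mem_real_span {n : Type*} {S : Set (Matrix n n ℂ)}
    (hS : ∀ B ∈ S, B.IsHermitian) {A : Matrix n n ℂ} (hA : A.IsHermitian)
    (hmem : A ∈ Submodule.span ℂ S) : A ∈ Submodule.span ℝ S := by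
  obtain ⟨k, c, g, rfl⟩ := Submodule.mem_span_set'.1 hmem
  have hre : ∑ i, c i • (g i : Matrix n n ℂ) = ∑ i, (c i).re • (g i : Matrix n n ℂ) := by
    have hstar : ∑ i, star (c i) • (g i : Matrix n n ℂ) = ∑ i, c i • (g i : Matrix n n ℂ) := by
      conv_rhs => rw [← hA.eq, conjTranspose_sum]
      refine Finset.sum_congr rfl fun i _ => ?_
      rw [conjTranspose_smul, (hS _ (g i).2).eq]
    have htwo : (2 : ℂ) • ∑ i, c i • (g i : Matrix n n ℂ) =
        (2 : ℂ) • ∑ i, (c i).re • (g i : Matrix n n ℂ) := by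
      conv_lhs => rw [two_smul]
      nth_rewrite 2 [← hstar]
      rw [← Finset.sum_add_distrib, Finset.smul_sum]
      refine Finset.sum_congr rfl fun i _ => ?_
      rw [← add_smul, RCLike.star_def, Complex.add_conj]
      ext a b
      simp [mul_assoc]
    exact smul_right_injective _ (two_ne_zero' ℂ) htwo
  rw [hre]
  exact Submodule.sum_mem _ fun i _ => Submodule.smul_mem _ _ (Submodule.subset_span (g i).2)

/-- A set of trace-one Hermitian matrices spanning all matrices over `ℂ` affinely spans
the space of trace-one Hermitian matrices. -/
theorem coe_affineSpan_eq_traceOne {n : Type*} [Fintype n] [DecidableEq n]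
    {S : Set (Matrix n n ℂ)} (hS : S ⊆ traceOne n) (hspan : Submodule.span ℂ S = ⊤) :
    (affineSpan ℝ S : Set (Matrix n n ℂ)) = traceOne n := by
  apply Set.Subset.antisymm
  · intro A hA
    refine affineSpan_induction hA (fun B hB => hS hB) ?_
    rintro c u v w ⟨hu, hu1⟩ ⟨hv, hv1⟩ ⟨hw, hw1⟩
    refine ⟨?_, by simp [hu1, hv1, hw1]⟩
    exact ((hu.sub hv).smul (IsSelfAdjoint.all c)).add hw
  · rintro A ⟨hA, hA1⟩
    have hmem : A ∈ Submodule.span ℝ S :=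
      hA.mem_real_span (fun B hB => (hS hB).1) (hspan ▸ Submodule.mem_top)
    obtain ⟨k, c, g, rfl⟩ := Submodule.mem_span_set'.1 hmem
    have hc : ∑ i, c i = 1 := by
      rw [trace_sum] at hA1
      simp only [trace_smul, (hS (g _).2).2] at hA1
      apply Complex.ofReal_injective
      simpa using hA1
    rw [← Finset.affineCombination_eq_linear_combination _ (fun i => (g i : Matrix n n ℂ)) c hc]
    refine affineSpan_mono ℝ ?_ (affineCombination_mem_affineSpan hc _)
    rintro _ ⟨i, rfl⟩
    exact (g i).2

/-- A nonempty convex set of matrices has nonempty interior relative to its affine span. -/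
theorem nonempty_interior_preimage_of_affineSpan_eq {n : Type*} [Fintype n]
    {K T : Set (Matrix n n ℂ)} (hK : Convex ℝ K) (hne : K.Nonempty)
    (hT : (affineSpan ℝ K : Set (Matrix n n ℂ)) = T) :
    (interior ((Subtype.val : T → Matrix n n ℂ) ⁻¹' K)).Nonempty := by
  let _ : NormedAddCommGroup (Matrix n n ℂ) := Matrix.normedAddCommGroup
  let _ : NormedSpace ℝ (Matrix n n ℂ) := Matrix.normedSpace
  subst hT
  obtain ⟨_, x, hx, -⟩ := hne.intrinsicInterior hK
  exact ⟨x, hx⟩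

/-- for unit vectors `φ¹ ∈ H₁`, `φ² ∈ H₂` with `dim Hᵢ = dᵢ > 1`, the convex
hull of the set of all pure separable states
`{(U₁ P_{φ¹} U₁†) ⊗ (U₂ P_{φ²} U₂†)}` (i.e. the set of separable mixed states) has
nonempty interior in the affine space `u*₁(H₁ ⊗ H₂)`. -/
theorem stmt8 (d₁ d₂ : ℕ) (h1 : 1 < d₁) (h2 : 1 < d₂)
    (φ₁ : Fin d₁ → ℂ) (φ₂ : Fin d₂ → ℂ) (hφ₁ : IsUnitVec φ₁) (hφ₂ : IsUnitVec φ₂) :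
    (interior ((Subtype.val :
        traceOne (Fin d₁ × Fin d₂) → Matrix (Fin d₁ × Fin d₂) (Fin d₁ × Fin d₂) ℂ) ⁻¹'
      (convexHull ℝ
        {B | ∃ U₁ ∈ Matrix.unitaryGroup (Fin d₁) ℂ, ∃ U₂ ∈ Matrix.unitaryGroup (Fin d₂) ℂ,
          B = (U₁ * pureState φ₁ * U₁ᴴ) ⊗ₖ (U₂ * pureState φ₂ * U₂ᴴ)}))).Nonempty := by
  set S := {B | ∃ U₁ ∈ Matrix.unitaryGroup (Fin d₁) ℂ, ∃ U₂ ∈ Matrix.unitaryGroup (Fin d₂) ℂ,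
    B = (U₁ * pureState φ₁ * U₁ᴴ) ⊗ₖ (U₂ * pureState φ₂ * U₂ᴴ)}
  have himage : S = Set.image2 (fun A B => A ⊗ₖ B) (pureStateOrbit φ₁) (pureStateOrbit φ₂) := by
    ext B
    constructor
    · rintro ⟨U₁, h₁, U₂, h₂, rfl⟩
      exact ⟨_, ⟨U₁, h₁, rfl⟩, _, ⟨U₂, h₂, rfl⟩, rfl⟩
    · rintro ⟨_, ⟨U₁, h₁, rfl⟩, _, ⟨U₂, h₂, rfl⟩, rfl⟩
      exact ⟨U₁, h₁, U₂, h₂, rfl⟩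
  have hsub : S ⊆ traceOne (Fin d₁ × Fin d₂) := by
    rintro _ ⟨U₁, h₁, U₂, h₂, rfl⟩
    constructor
    · rw [mul_pureState_mul_conjTranspose, mul_pureState_mul_conjTranspose, IsHermitian,
        conjTranspose_kronecker, (pureState_isHermitian _).eq, (pureState_isHermitian _).eq]
    · rw [trace_kronecker, trace_mul_mul_conjTranspose_of_mem_unitaryGroup h₁,
        trace_mul_mul_conjTranspose_of_mem_unitaryGroup h₂, hφ₁.trace_pureState,
        hφ₂.trace_pureState, mul_one]
  have hspan : Submodule.span ℂ S = ⊤ := by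
    rw [himage]
    exact span_image2_kronecker_eq_top (span_pureStateOrbit hφ₁) (span_pureStateOrbit hφ₂)
  have hne : S.Nonempty := ⟨_, 1, one_mem _, 1, one_mem _, rfl⟩
  refine nonempty_interior_preimage_of_affineSpan_eq (convex_convexHull ℝ S) hne.convexHull ?_
  rw [affineSpan_convexHull, coe_affineSpan_eq_traceOne hsub hspan]

end
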